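/- arXiv:1704.02401 — 9 statements merged into one kernel-verified Lean document; each statement's English description precedes it below -/
import Mathlib

section
/- Let B be a finite abelian group and α a normalized 3-cocycle on B with values in ℚ/ℤ. Then the following are equivalent: (i) there exists a normalized 2-cochain u : B × B → ℚ/ℤ such that α + du is soft, where (du)(x,y,z) = u(y,z) − u(x+y,z) + u(x,y+z) − u(x,y); (ii) the alternation Alt₃(α) is identically zero, where Alt₃(α)(x,y,z) := α(x,y,z) − α(y,x,z) − α(x,z,y) + α(y,z,x) + α(z,x,y) − α(z,y,x). -/
/-- ℚ/ℤ. -/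
abbrev QZ := AddCircle (1 : ℚ)

/-- `α(x,y|g)` for a 3-cochain on an abelian group. -/
def cochainBar {B : Type*} [AddCommGroup B] (α : B → B → B → QZ) (x y g : B) : QZ :=
  α x g y - α x y g - α g x y

/-- A 3-cochain `α` on an abelian group `B` is soft if for every `g` there is `c : B → ℚ/ℤ`
with `c x + c y + α(x,y|g) = c (x+y)` for all `x y`. -/
def IsSoft {B : Type*} [AddCommGroup B] (α : B → B → B → QZ) : Prop :=
  ∀ g : B, ∃ c : B → QZ, ∀ x y : B, c x + c y + cochainBar α x y g = c (x + y)

/-- The alternation `Alt₃`. -/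
def Alt3 {B : Type*} [AddCommGroup B] (α : B → B → B → QZ) (x y z : B) : QZ :=
  α x y z - α y x z - α x z y + α y z x + α z x y - α z y x

/-- The underlying type of the extension of `B` by `A` defined by a symmetric 2-cocycle. -/
@[ext]
structure CocycleExtension {A B : Type*} (f : B → B → A) where
  fiber : A
  base : B

/-- The abelian group structure on the extension defined by a normalized symmetric 2-cocycle. -/
abbrev CocycleExtension.addCommGroup {A B : Type*} [AddCommGroup A] [AddCommGroup B]
    (f : B → B → A) (hsymm : ∀ x y, f x y = f y x) (hzero : ∀ y, f 0 y = 0)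
    (hcoc : ∀ x y z, f y z - f (x + y) z + f x (y + z) - f x y = 0) :
    AddCommGroup (CocycleExtension f) :=
  letI : Add (CocycleExtension f) :=
    ⟨fun p q => ⟨p.fiber + q.fiber + f p.base q.base, p.base + q.base⟩⟩
  letI : Zero (CocycleExtension f) := ⟨⟨0, 0⟩⟩
  letI : Neg (CocycleExtension f) := ⟨fun p => ⟨-p.fiber - f (-p.base) p.base, -p.base⟩⟩
  { add_assoc := by
      rintro ⟨a, x⟩ ⟨b, y⟩ ⟨c, z⟩
      have h := hcoc x y z
      refine CocycleExtension.ext ?_ (add_assoc x y z)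
      change a + b + f x y + c + f (x + y) z = a + (b + c + f y z) + f x (y + z)
      rw [← sub_eq_zero, ← neg_eq_zero, ← h]
      abel
    zero_add := by
      rintro ⟨a, x⟩
      refine CocycleExtension.ext ?_ (zero_add x)
      change 0 + a + f 0 x = a
      rw [hzero, zero_add, add_zero]
    add_zero := by
      rintro ⟨a, x⟩
      refine CocycleExtension.ext ?_ (add_zero x)
      change a + 0 + f x 0 = a
      rw [hsymm, hzero, add_zero, add_zero]
    neg_add_cancel := by
      rintro ⟨a, x⟩
      refine CocycleExtension.ext ?_ (neg_add_cancel x)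
      change -a - f (-x) x + a + f (-x) x = 0
      abel
    add_comm := by
      rintro ⟨a, x⟩ ⟨b, y⟩
      refine CocycleExtension.ext ?_ (add_comm x y)
      change a + b + f x y = b + a + f y x
      rw [hsymm x y, add_comm a b]
    nsmul := nsmulRec
    zsmul := zsmulRec }

/-- A normalized symmetric 2-cocycle with values in a divisible group is a coboundary. -/
theorem exists_coboundary_of_symmetric_cocycle {A B : Type*} [AddCommGroup A]
    [DivisibleBy A ℤ] [AddCommGroup B] (f : B → B → A)
    (hsymm : ∀ x y, f x y = f y x) (hzero : ∀ y, f 0 y = 0)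
    (hcoc : ∀ x y z, f y z - f (x + y) z + f x (y + z) - f x y = 0) :
    ∃ c : B → A, ∀ x y, c x + c y + f x y = c (x + y) := by
  let := CocycleExtension.addCommGroup f hsymm hzero hcoc
  have hadd (a b : A) (x y : B) :
      (⟨a, x⟩ + ⟨b, y⟩ : CocycleExtension f) = ⟨a + b + f x y, x + y⟩ := rfl
  let ι : A →+ CocycleExtension f :=
    { toFun := fun a => ⟨a, 0⟩
      map_zero' := rfl
      map_add' := fun a b => by rw [hadd, hzero, add_zero, add_zero] }
  have hι : Function.Injective ι := fun a b h => congrArg CocycleExtension.fiber h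
  obtain ⟨r, hr⟩ :=
    (Module.Baer.of_divisible A).extension_property_addMonoidHom ι hι (AddMonoidHom.id A)
  have hr' (a : A) (x : B) : r ⟨a, x⟩ = a + r ⟨0, x⟩ := by
    have h : r ⟨a, 0⟩ = a := DFunLike.congr_fun hr a
    rw [← congrArg (· + r ⟨0, x⟩) h, ← map_add, hadd, hzero, add_zero, add_zero, zero_add]
  refine ⟨fun x => -r ⟨0, x⟩, fun x y => ?_⟩
  have h := map_add r ⟨0, x⟩ ⟨0, y⟩
  rw [hadd, hr', add_zero, zero_add] at h
  rw [← neg_add, ← h, neg_add_rev, neg_add_cancel_right]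

theorem cochainBar_sub_swap {B : Type*} [AddCommGroup B] (α : B → B → B → QZ) (x y g : B) :
    cochainBar α x y g - cochainBar α y x g = -Alt3 α x y g := by
  unfold cochainBar Alt3
  abel

theorem IsSoft.alt3_eq_zero {B : Type*} [AddCommGroup B] {α : B → B → B → QZ}
    (hα : IsSoft α) (x y z : B) : Alt3 α x y z = 0 := by
  obtain ⟨c, hc⟩ := hα z
  have h : cochainBar α x y z = cochainBar α y x z := by
    apply add_left_cancel (a := c x + c y)
    rw [hc, add_comm (c x), hc, add_comm]
  rw [← neg_eq_zero, ← cochainBar_sub_swap, h, sub_self]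

/-- The alternation is unchanged by adding a coboundary. -/
theorem Alt3_add_coboundary {B : Type*} [AddCommGroup B] (α : B → B → B → QZ)
    (u : B → B → QZ) (x y z : B) :
    Alt3 (fun x y z => α x y z + (u y z - u (x + y) z + u x (y + z) - u x y)) x y z =
      Alt3 α x y z := by
  simp only [Alt3, add_comm y x, add_comm z x, add_comm z y]
  abel

/-- For a 3-cocycle `α`, the 2-cochain `cochainBar α · · g` is a 2-cocycle. -/
theorem cochainBar_cocycle {B : Type*} [AddCommGroup B] {α : B → B → B → QZ}
    (hcoc : ∀ x y z w : B,
      α y z w - α (x + y) z w + α x (y + z) w - α x y (z + w) + α x y z = 0)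
    (g x y z : B) :
    cochainBar α y z g - cochainBar α (x + y) z g + cochainBar α x (y + z) g
      - cochainBar α x y g = 0 := by
  have h₁ := hcoc g x y z
  have h₂ := hcoc x g y z
  have h₃ := hcoc x y g z
  have h₄ := hcoc x y z g
  rw [add_comm g x] at h₁
  rw [add_comm g y] at h₂
  rw [add_comm g z] at h₃
  unfold cochainBar
  grind

/-- A normalized 3-cocycle with vanishing alternation is soft. -/
theorem isSoft_of_alt3_eq_zero {B : Type*} [AddCommGroup B] {α : B → B → B → QZ}
    (hcoc : ∀ x y z w : B,
      α y z w - α (x + y) z w + α x (y + z) w - α x y (z + w) + α x y z = 0)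
    (hnorm : ∀ x y z : B, x = 0 ∨ y = 0 ∨ z = 0 → α x y z = 0)
    (halt : ∀ x y z : B, Alt3 α x y z = 0) : IsSoft α := fun g =>
  exists_coboundary_of_symmetric_cocycle (fun x y => cochainBar α x y g)
    (fun x y => by rw [← sub_eq_zero, cochainBar_sub_swap, halt, neg_zero])
    (fun y => by simp [cochainBar, hnorm])
    (cochainBar_cocycle hcoc g)

theorem soft_iff_alt3_vanishes {B : Type*} [AddCommGroup B] [Finite B]
    (α : B → B → B → QZ)
    (hcoc : ∀ x y z w : B,
      α y z w - α (x + y) z w + α x (y + z) w - α x y (z + w) + α x y z = 0)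
    (hnorm : ∀ x y z : B, x = 0 ∨ y = 0 ∨ z = 0 → α x y z = 0) :
    (∃ u : B → B → QZ, (∀ x y : B, u 0 y = 0 ∧ u x 0 = 0) ∧
      IsSoft (fun x y z =>
        α x y z + (u y z - u (x + y) z + u x (y + z) - u x y))) ↔
    (∀ x y z : B, Alt3 α x y z = 0) := by
  constructor
  · rintro ⟨u, -, hu⟩ x y z
    rw [← Alt3_add_coboundary α u]
    exact hu.alt3_eq_zero x y z
  · intro halt
    refine ⟨fun _ _ => 0, fun _ _ => ⟨rfl, rfl⟩, ?_⟩
    simpa using isSoft_of_alt3_eq_zero hcoc hnorm halt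
end

section
/- Let B be a finite abelian group and let ω : B × B × B → ℚ/ℤ be additive in each variable and alternating (ω(x,y,z) = 0 whenever two of the three arguments are equal). Then there exists a normalized 3-cocycle α on B with values in ℚ/ℤ whose alternation equals ω, i.e. α(x,y,z) − α(y,x,z) − α(x,z,y) + α(y,z,x) + α(z,x,y) − α(z,y,x) = ω(x,y,z) for all x,y,z ∈ B. (This is the surjectivity of the alternation map H³(B,ℚ/ℤ) → Hom(Λ³B,ℚ/ℤ).) -/
/-- A finite abelian group has a decomposition of the identity into endomorphisms with cyclic
images. -/
theorem exists_sum_endomorphisms_cyclic (B : Type*) [AddCommGroup B] [Finite B] :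
    ∃ (n : ℕ) (p : Fin n → B →+ B) (b : Fin n → B),
      (∀ x, ∑ i, p i x = x) ∧ ∀ i x, ∃ m : ℤ, p i x = m • b i := by
  classical
  obtain ⟨ι, _, q, _, e, ⟨f⟩⟩ := AddCommGroup.equiv_directSum_zmod_of_finite B
  let σ := Fintype.equivFin ι
  let incl (i : ι) := DirectSum.of (fun j => ZMod (q j ^ e j)) i
  refine ⟨Fintype.card ι,
    fun k => f.symm.toAddMonoidHom.comp ((incl (σ.symm k)).comp
      ((DFinsupp.evalAddMonoidHom (σ.symm k)).comp f.toAddMonoidHom)),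
    fun k => f.symm (incl (σ.symm k) 1), fun x => ?_, fun k x => ?_⟩
  · change ∑ k, f.symm (incl (σ.symm k) (f x (σ.symm k))) = x
    rw [σ.symm.sum_comp (fun i => f.symm (incl i (f x i))), ← map_sum,
      DirectSum.sum_univ_of, f.symm_apply_apply]
  · obtain ⟨m, hm⟩ := ZMod.intCast_surjective (f x (σ.symm k))
    refine ⟨m, ?_⟩
    change f.symm (incl (σ.symm k) (f x (σ.symm k))) = _
    rw [← hm, ← map_zsmul, ← map_zsmul, zsmul_one]

/-- A function of three variables that vanishes whenever two of them coincide has total sum equal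
to the sum over increasing triples of its values at all permutations of the triple. -/
theorem sum_eq_sum_increasing_permutations {ι M : Type*} [Fintype ι] [LinearOrder ι]
    [AddCommGroup M] (f : ι → ι → ι → M)
    (hf : ∀ i j k, i = j ∨ j = k ∨ i = k → f i j k = 0) :
    ∑ i, ∑ j, ∑ k, f i j k =
      ∑ i, ∑ j, ∑ k, if i < j ∧ j < k then
        f i j k + f j i k + f i k j + f k i j + f j k i + f k j i else 0 := by
  have h (i j k : ι) : f i j k =
      (if i < j ∧ j < k then f i j k else 0) + (if j < i ∧ i < k then f i j k else 0) +
      (if i < k ∧ k < j then f i j k else 0) + (if j < k ∧ k < i then f i j k else 0) +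
      (if k < i ∧ i < j then f i j k else 0) + (if k < j ∧ j < i then f i j k else 0) := by
    by_cases h0 : i = j ∨ j = k ∨ i = k
    · simp [hf i j k h0]
    push Not at h0
    obtain ⟨hij, hjk, hik⟩ := h0
    rcases hij.lt_or_gt with h1 | h1 <;> rcases hjk.lt_or_gt with h2 | h2 <;>
      rcases hik.lt_or_gt with h3 | h3 <;>
      first
        | (exfalso; order)
        | simp [h1, h2, h3, h1.not_gt, h2.not_gt, h3.not_gt]
  have swap₁ (g : ι → ι → ι → M) : ∑ i, ∑ j, ∑ k, g i j k = ∑ i, ∑ j, ∑ k, g j i k :=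
    Finset.sum_comm
  have swap₂ (g : ι → ι → ι → M) : ∑ i, ∑ j, ∑ k, g i j k = ∑ i, ∑ j, ∑ k, g i k j :=
    Finset.sum_congr rfl fun _ _ => Finset.sum_comm
  have hsplit (i j k : ι) : (if i < j ∧ j < k then
        f i j k + f j i k + f i k j + f k i j + f j k i + f k j i else 0) =
      (if i < j ∧ j < k then f i j k else 0) + (if i < j ∧ j < k then f j i k else 0) +
      (if i < j ∧ j < k then f i k j else 0) + (if i < j ∧ j < k then f k i j else 0) +
      (if i < j ∧ j < k then f j k i else 0) + (if i < j ∧ j < k then f k j i else 0) := by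
    split_ifs <;> simp
  simp_rw [hsplit]
  rw [Finset.sum_congr rfl fun i _ => Finset.sum_congr rfl fun j _ =>
    Finset.sum_congr rfl fun k _ => h i j k]
  simp only [Finset.sum_add_distrib]
  congr 1; congr 1; congr 1; congr 1; congr 1
  · exact swap₁ _
  · exact swap₂ _
  · rw [swap₁, swap₂]
  · rw [swap₂, swap₁]
  · rw [swap₁, swap₂, swap₁]

theorem alternation_surjective {B : Type*} [AddCommGroup B] [Finite B]
    (ω : B → B → B → QZ)
    (hadd₁ : ∀ x x' y z : B, ω (x + x') y z = ω x y z + ω x' y z)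
    (hadd₂ : ∀ x y y' z : B, ω x (y + y') z = ω x y z + ω x y' z)
    (hadd₃ : ∀ x y z z' : B, ω x y (z + z') = ω x y z + ω x y z')
    (halt : ∀ x y z : B, x = y ∨ y = z ∨ x = z → ω x y z = 0) :
    ∃ α : B → B → B → QZ,
      (∀ x y z w : B,
        α y z w - α (x + y) z w + α x (y + z) w - α x y (z + w) + α x y z = 0) ∧
      (∀ x y z : B, x = 0 ∨ y = 0 ∨ z = 0 → α x y z = 0) ∧
      (∀ x y z : B, Alt3 α x y z = ω x y z) := by
  let W : B →+ B →+ B →+ QZ :=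
    AddMonoidHom.mk' (fun x => AddMonoidHom.mk' (fun y => AddMonoidHom.mk' (ω x y) (hadd₃ x y))
      fun y y' => by ext z; exact hadd₂ x y y' z)
      fun x x' => by ext y z; exact hadd₁ x x' y z
  have hW (x y z : B) : ω x y z = W x y z := rfl
  have swap₁₂ (x y z : B) : W x y z = -W y x z := by
    have h : W (x + y) (x + y) z = 0 := halt _ _ _ (.inl rfl)
    have hx : W x x z = 0 := halt _ _ _ (.inl rfl)
    have hy : W y y z = 0 := halt _ _ _ (.inl rfl)
    simp only [map_add, AddMonoidHom.add_apply, hx, hy, zero_add, add_zero] at h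
    exact eq_neg_of_add_eq_zero_right h
  have swap₂₃ (x y z : B) : W x y z = -W x z y := by
    have h : W x (y + z) (y + z) = 0 := halt _ _ _ (.inr (.inl rfl))
    have hy : W x y y = 0 := halt _ _ _ (.inr (.inl rfl))
    have hz : W x z z = 0 := halt _ _ _ (.inr (.inl rfl))
    simp only [map_add, AddMonoidHom.add_apply, hy, hz, zero_add, add_zero] at h
    exact eq_neg_of_add_eq_zero_right h
  obtain ⟨n, p, b, hsum, hcyc⟩ := exists_sum_endomorphisms_cyclic B
  let α (x y z : B) : QZ :=
    ∑ i, ∑ j, ∑ k, if i < j ∧ j < k then W (p i x) (p j y) (p k z) else 0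
  have hα (x y z : B) :
      α x y z = ∑ i, ∑ j, ∑ k, if i < j ∧ j < k then W (p i x) (p j y) (p k z) else 0 := rfl
  have add₁ (x x' y z : B) : α (x + x') y z = α x y z + α x' y z := by
    simp only [hα, ← Finset.sum_add_distrib]
    refine Finset.sum_congr rfl fun i _ => Finset.sum_congr rfl fun j _ =>
      Finset.sum_congr rfl fun k _ => ?_
    split_ifs <;> simp
  have add₂ (x y y' z : B) : α x (y + y') z = α x y z + α x y' z := by
    simp only [hα, ← Finset.sum_add_distrib]
    refine Finset.sum_congr rfl fun i _ => Finset.sum_congr rfl fun j _ =>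
      Finset.sum_congr rfl fun k _ => ?_
    split_ifs <;> simp
  have add₃ (x y z z' : B) : α x y (z + z') = α x y z + α x y z' := by
    simp only [hα, ← Finset.sum_add_distrib]
    refine Finset.sum_congr rfl fun i _ => Finset.sum_congr rfl fun j _ =>
      Finset.sum_congr rfl fun k _ => ?_
    split_ifs <;> simp
  refine ⟨α, fun x y z w => ?_, ?_, fun x y z => ?_⟩
  · rw [add₁, add₂, add₃]
    abel
  · rintro x y z (rfl | rfl | rfl) <;> simp [hα]
  · have hexpand : ω x y z = ∑ i, ∑ j, ∑ k, W (p i x) (p j y) (p k z) := by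
      conv_lhs => rw [hW, ← hsum x, ← hsum y, ← hsum z]
      rw [map_sum W, AddMonoidHom.finsetSum_apply, AddMonoidHom.finsetSum_apply]
      refine Finset.sum_congr rfl fun i _ => ?_
      rw [map_sum (W (p i x)), AddMonoidHom.finsetSum_apply]
      exact Finset.sum_congr rfl fun j _ => map_sum _ _ _
    have hzero (i j k : Fin n) (h : i = j ∨ j = k ∨ i = k) :
        W (p i x) (p j y) (p k z) = 0 := by
      obtain ⟨l, hl⟩ := hcyc i x
      obtain ⟨m, hm⟩ := hcyc j y
      obtain ⟨r, hr⟩ := hcyc k z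
      have hb : W (b i) (b j) (b k) = 0 := halt _ _ _ (by
        rcases h with rfl | rfl | rfl <;> simp)
      rw [hl, hm, hr]
      simp [hb]
    rw [hexpand, sum_eq_sum_increasing_permutations _ hzero]
    simp only [Alt3, hα, ← Finset.sum_add_distrib, ← Finset.sum_sub_distrib]
    refine Finset.sum_congr rfl fun i _ => Finset.sum_congr rfl fun j _ =>
      Finset.sum_congr rfl fun k _ => ?_
    split_ifs
    · have h₁ := swap₁₂ (p i y) (p j x) (p k z)
      have h₂ := swap₂₃ (p i x) (p j z) (p k y)
      have h₃ : W (p i y) (p j z) (p k x) = W (p k x) (p i y) (p j z) := by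
        rw [swap₂₃, swap₁₂, neg_neg]
      have h₄ : W (p i z) (p j x) (p k y) = W (p j x) (p k y) (p i z) := by
        rw [swap₁₂, swap₂₃, neg_neg]
      have h₅ : W (p i z) (p j y) (p k x) = -W (p k x) (p j y) (p i z) := by
        rw [swap₁₂, swap₂₃, swap₁₂, neg_neg]
      rw [h₁, h₂, h₃, h₄, h₅]
      abel
    · simp
end

section
/- Let B be a finite abelian group and α a normalized 3-cocycle on B with values in ℚ/ℤ. Then its alternation Alt₃(α)(x,y,z) := α(x,y,z) − α(y,x,z) − α(x,z,y) + α(y,z,x) + α(z,x,y) − α(z,y,x) is additive in each of the three variables and alternating (it vanishes whenever two of the arguments coincide). Moreover, if α = du is a coboundary of a normalized 2-cochain u (i.e. α(x,y,z) = u(y,z) − u(x+y,z) + u(x,y+z) − u(x,y)), then Alt₃(α) is identically zero. -/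
/-- The slant product of a 3-cochain with `x`. -/
def slant {B : Type*} (α : B → B → B → QZ) (x y z : B) : QZ :=
  α x y z - α y x z + α y z x

theorem Alt3_eq_slant_sub_slant {B : Type*} [AddCommGroup B] (α : B → B → B → QZ) (x y z : B) :
    Alt3 α x y z = slant α x y z - slant α x z y := by
  unfold Alt3 slant
  abel

theorem Alt3_rotate {B : Type*} [AddCommGroup B] (α : B → B → B → QZ) (x y z : B) :
    Alt3 α x y z = Alt3 α y z x := by
  unfold Alt3
  abel

/-- The slant product of a 3-cocycle on an abelian group is a 2-cocycle. -/
theorem slant_cocycle {B : Type*} [AddCommGroup B] (α : B → B → B → QZ)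
    (hcoc : ∀ x y z w : B,
      α y z w - α (x + y) z w + α x (y + z) w - α x y (z + w) + α x y z = 0)
    (x a b c : B) :
    slant α x b c - slant α x (a + b) c + slant α x a (b + c) - slant α x a b = 0 := by
  have h₁ := hcoc x a b c
  have h₂ := hcoc a x b c
  have h₃ := hcoc a b x c
  have h₄ := hcoc a b c x
  rw [add_comm x a] at h₁
  rw [add_comm x b] at h₂
  rw [add_comm x c] at h₃
  unfold slant
  linear_combination (norm := abel) -h₁ + h₂ - h₃ + h₄

/-- The antisymmetrization of a 2-cocycle on an abelian group is additive. -/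
theorem antisymmetrization_add_left {B : Type*} [AddCommGroup B] (β : B → B → QZ)
    (hβ : ∀ a b c : B, β b c - β (a + b) c + β a (b + c) - β a b = 0) (y y' z : B) :
    β (y + y') z - β z (y + y') = (β y z - β z y) + (β y' z - β z y') := by
  have h₁ := hβ y y' z
  have h₂ := hβ y z y'
  have h₃ := hβ z y y'
  rw [add_comm y' z] at h₁
  rw [add_comm z y] at h₃
  linear_combination (norm := abel) -h₁ + h₂ - h₃

theorem Alt3_add_middle {B : Type*} [AddCommGroup B] (α : B → B → B → QZ)
    (hcoc : ∀ x y z w : B,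
      α y z w - α (x + y) z w + α x (y + z) w - α x y (z + w) + α x y z = 0)
    (x y y' z : B) :
    Alt3 α x (y + y') z = Alt3 α x y z + Alt3 α x y' z := by
  simp only [Alt3_eq_slant_sub_slant]
  exact antisymmetrization_add_left (slant α x) (slant_cocycle α hcoc x) y y' z


theorem alt3_trilinear_alternating {B : Type*} [AddCommGroup B] [Finite B]
    (α : B → B → B → QZ)
    (hcoc : ∀ x y z w : B,
      α y z w - α (x + y) z w + α x (y + z) w - α x y (z + w) + α x y z = 0)
    (hnorm : ∀ x y z : B, x = 0 ∨ y = 0 ∨ z = 0 → α x y z = 0) :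
    -- additivity in each variable
    (∀ x x' y z : B, Alt3 α (x + x') y z = Alt3 α x y z + Alt3 α x' y z) ∧
    (∀ x y y' z : B, Alt3 α x (y + y') z = Alt3 α x y z + Alt3 α x y' z) ∧
    (∀ x y z z' : B, Alt3 α x y (z + z') = Alt3 α x y z + Alt3 α x y z') ∧
    -- alternating
    (∀ x y z : B, x = y ∨ y = z ∨ x = z → Alt3 α x y z = 0) ∧
    -- coboundaries have vanishing alternation
    (∀ u : B → B → QZ, (∀ x y : B, u 0 y = 0 ∧ u x 0 = 0) →
      (∀ x y z : B, α x y z = u y z - u (x + y) z + u x (y + z) - u x y) →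
      ∀ x y z : B, Alt3 α x y z = 0) := by
  have hmid := Alt3_add_middle α hcoc
  refine ⟨fun x x' y z => ?_, hmid, fun x y z z' => ?_, ?_, ?_⟩
  · simpa only [← Alt3_rotate α z] using hmid z x x' y
  · simpa only [← Alt3_rotate α x] using hmid y z z' x
  · rintro x y z (rfl | rfl | rfl) <;> unfold Alt3 <;> abel
  · intro u _ hu x y z
    simp only [Alt3, hu, add_comm y x, add_comm z x, add_comm z y]
    abel
end

section
/- Let B be a finite abelian group of odd order and let q : B → ℚ/ℤ be a quadratic function. Then there exists a function ς : B × B → ℚ/ℤ, additive in each variable, such that q(x) = ς(x,x) for all x ∈ B. (Equivalently, the group J(B) := coker(Hom(B ⊗ B, ℚ/ℤ) → Q(B,ℚ/ℤ)) vanishes for B of odd order.) -/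
/-- The polarisation of a function `q : A → ℚ/ℤ`. -/
def polar {A : Type*} [AddCommGroup A] (q : A → QZ) (x y : A) : QZ :=
  q (x + y) - q x - q y

/-- A quadratic function on an abelian group with values in ℚ/ℤ. -/
def IsQuadratic {A : Type*} [AddCommGroup A] (q : A → QZ) : Prop :=
  (∀ (n : ℤ) (x : A), q (n • x) = n ^ 2 • q x) ∧
  (∀ x x' y : A, polar q (x + x') y = polar q x y + polar q x' y) ∧
  (∀ x y y' : A, polar q x (y + y') = polar q x y + polar q x y')

/-- A biadditive form on an abelian group with values in ℚ/ℤ. -/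
def IsBiadditive {A : Type*} [AddCommGroup A] (ς : A → A → QZ) : Prop :=
  (∀ x x' y : A, ς (x + x') y = ς x y + ς x' y) ∧
  (∀ x y y' : A, ς x (y + y') = ς x y + ς x y')

theorem IsQuadratic.polar_self {A : Type*} [AddCommGroup A] {q : A → QZ}
    (hq : IsQuadratic q) (x : A) : polar q x x = (2 : ℤ) • q x := by
  have h := hq.1 2 x
  rw [two_zsmul] at h
  rw [polar, h]
  module

/-- A quadratic function on a finite group is annihilated by the order of the group
when that order is odd. -/
theorem IsQuadratic.card_nsmul_eq_zero {B : Type*} [AddCommGroup B] [Fintype B]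
    (hodd : Odd (Fintype.card B)) {q : B → QZ} (hq : IsQuadratic q) (x : B) :
    Fintype.card B • q x = 0 := by
  obtain ⟨k, hk⟩ := hodd
  have hx : Fintype.card B • x = 0 := _root_.card_nsmul_eq_zero
  have h_zero : q 0 = 0 := by simpa using hq.1 0 0
  have h_sq : (Fintype.card B : ℤ) ^ 2 • q x = 0 := by
    rw [← hq.1, natCast_zsmul, hx, h_zero]
  let f : B →+ QZ := AddMonoidHom.mk' (fun y => polar q y x) fun y y' => hq.2.1 y y' x
  have h_two : Fintype.card B • polar q x x = 0 := by
    change Fintype.card B • f x = 0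
    rw [← map_nsmul, hx, map_zero]
  rw [hq.polar_self] at h_two
  rw [hk] at h_sq h_two ⊢
  have h_comb : (2 * k + 1) • q x =
      ((2 * k + 1 : ℕ) : ℤ) ^ 2 • q x - k • (2 * k + 1) • (2 : ℤ) • q x := by
    push_cast
    module
  rw [h_comb, h_sq, h_two, smul_zero, sub_zero]

theorem quadratic_of_odd_order_is_diagonal {B : Type*} [AddCommGroup B] [Fintype B]
    (hodd : Odd (Fintype.card B)) (q : B → QZ) (hq : IsQuadratic q) :
    ∃ ς : B → B → QZ, IsBiadditive ς ∧ ∀ x : B, q x = ς x x := by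
  obtain ⟨k, hk⟩ := id hodd
  refine ⟨fun x y => (k + 1) • polar q x y, ⟨fun x x' y => ?_, fun x y y' => ?_⟩, fun x => ?_⟩
  · simp only [hq.2.1, smul_add]
  · simp only [hq.2.2, smul_add]
  · have h := hq.card_nsmul_eq_zero hodd x
    rw [hk] at h
    have h_comb : (k + 1) • (2 : ℤ) • q x = q x + (2 * k + 1) • q x := by module
    simp only [hq.polar_self, h_comb, h, add_zero]
end

section
/- Let ℓ ≥ 1 be a natural number. The set Q(ℤ/2^ℓℤ, ℚ/ℤ) of quadratic functions on ℤ/2^ℓℤ with values in ℚ/ℤ is an abelian group under pointwise addition; it is cyclic of order 2^(ℓ+1), generated by the function q_ℓ defined by q_ℓ(x) = (x̄² / 2^(ℓ+1)) mod ℤ, where x̄ ∈ {0,1,…,2^ℓ − 1} is the canonical representative of x ∈ ℤ/2^ℓℤ. In particular, q_ℓ is a quadratic function, every quadratic function on ℤ/2^ℓℤ equals m • q_ℓ for some integer m, and the order of q_ℓ in Q(ℤ/2^ℓℤ, ℚ/ℤ) is exactly 2^(ℓ+1). -/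
/-- The standard generator `q_ℓ(x) = x̄²/2^(ℓ+1)` of the group of quadratic
functions on `ℤ/2^ℓℤ`. -/
noncomputable def qGen (ℓ : ℕ) (x : ZMod (2 ^ ℓ)) : QZ :=
  (((x.val ^ 2 : ℚ) / 2 ^ (ℓ + 1) : ℚ) : QZ)

theorem QZ.coe_eq_zero_iff (r : ℚ) : (r : QZ) = 0 ↔ ∃ n : ℤ, (n : ℚ) = r := by
  rw [AddCircle.coe_eq_zero_iff]
  simp

theorem QZ.coe_eq_coe_of_sub_eq {r s : ℚ} (n : ℤ) (h : r - s = n) : (r : QZ) = (s : QZ) := by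
  rw [← sub_eq_zero, ← AddCircle.coe_sub, QZ.coe_eq_zero_iff]
  exact ⟨n, h.symm⟩

theorem QZ.zsmul_coe (n : ℤ) (r : ℚ) : n • (r : QZ) = ((n * r : ℚ) : QZ) := by
  rw [← AddCircle.coe_zsmul, zsmul_eq_mul]

/-- The formula defining `qGen` holds for every integer representative. -/
theorem qGen_intCast {ℓ : ℕ} (hℓ : 1 ≤ ℓ) (a : ℤ) :
    qGen ℓ (a : ZMod (2 ^ ℓ)) = (((a : ℚ) ^ 2 / 2 ^ (ℓ + 1) : ℚ) : QZ) := by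
  have hdvd : ((2 ^ ℓ : ℕ) : ℤ) ∣ a - ((a : ZMod (2 ^ ℓ)).val : ℤ) := by
    rw [← ZMod.intCast_zmod_eq_zero_iff_dvd]
    simp
  obtain ⟨k, hk⟩ := hdvd
  obtain ⟨j, rfl⟩ : ∃ j, ℓ = j + 1 := ⟨ℓ - 1, by omega⟩
  unfold qGen
  set v := (a : ZMod (2 ^ (j + 1))).val
  have ha : (a : ℚ) = v + 2 ^ (j + 1) * k := by
    have h : a = v + 2 ^ (j + 1) * k := by
      push_cast at hk
      linarith
    exact_mod_cast h
  apply QZ.coe_eq_coe_of_sub_eq (-(v * k + 2 ^ j * k ^ 2))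
  rw [ha]
  push_cast
  field_simp
  ring

theorem polar_qGen_intCast {ℓ : ℕ} (hℓ : 1 ≤ ℓ) (a b : ℤ) :
    polar (qGen ℓ) (a : ZMod (2 ^ ℓ)) (b : ZMod (2 ^ ℓ)) =
      (((a : ℚ) * b / 2 ^ ℓ : ℚ) : QZ) := by
  unfold polar
  rw [← Int.cast_add, qGen_intCast hℓ, qGen_intCast hℓ, qGen_intCast hℓ, ← AddCircle.coe_sub,
    ← AddCircle.coe_sub]
  congr 1
  push_cast
  field_simp
  ring

theorem isQuadratic_qGen {ℓ : ℕ} (hℓ : 1 ≤ ℓ) : IsQuadratic (qGen ℓ) := by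
  refine ⟨fun n x => ?_, fun x x' y => ?_, fun x y y' => ?_⟩
  · obtain ⟨a, rfl⟩ := ZMod.intCast_surjective x
    rw [zsmul_eq_mul, ← Int.cast_mul, qGen_intCast hℓ, qGen_intCast hℓ, QZ.zsmul_coe]
    congr 1
    push_cast
    ring
  · obtain ⟨a, rfl⟩ := ZMod.intCast_surjective x
    obtain ⟨a', rfl⟩ := ZMod.intCast_surjective x'
    obtain ⟨b, rfl⟩ := ZMod.intCast_surjective y
    rw [← Int.cast_add, polar_qGen_intCast hℓ, polar_qGen_intCast hℓ, polar_qGen_intCast hℓ,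
      ← AddCircle.coe_add]
    congr 1
    push_cast
    ring
  · obtain ⟨a, rfl⟩ := ZMod.intCast_surjective x
    obtain ⟨b, rfl⟩ := ZMod.intCast_surjective y
    obtain ⟨b', rfl⟩ := ZMod.intCast_surjective y'
    rw [← Int.cast_add, polar_qGen_intCast hℓ, polar_qGen_intCast hℓ, polar_qGen_intCast hℓ,
      ← AddCircle.coe_add]
    congr 1
    push_cast
    ring

theorem IsQuadratic.apply_intCast {N : ℕ} {q : ZMod N → QZ} (hq : IsQuadratic q) (a : ℤ) :
    q (a : ZMod N) = a ^ 2 • q 1 := by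
  rw [← hq.1 a 1, zsmul_one]

theorem IsQuadratic.two_mul_zsmul_apply_one {N : ℕ} {q : ZMod N → QZ} (hq : IsQuadratic q) :
    (2 * N : ℤ) • q 1 = 0 := by
  have h₁ := hq.apply_intCast (N : ℤ)
  have h₀ := hq.apply_intCast 0
  have h₂ := hq.apply_intCast (1 + N : ℤ)
  simp only [Int.cast_zero, Int.cast_natCast, ZMod.natCast_self, Int.cast_add, Int.cast_one,
    add_zero] at h₀ h₁ h₂
  rw [show (1 + (N : ℤ)) ^ 2 = 1 + 2 * N + N ^ 2 by ring, add_smul, add_smul, one_smul, ← h₁,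
    h₀] at h₂
  simpa using h₂

theorem IsQuadratic.exists_eq_zsmul_qGen {ℓ : ℕ} (hℓ : 1 ≤ ℓ) {q : ZMod (2 ^ ℓ) → QZ}
    (hq : IsQuadratic q) : ∃ m : ℤ, ∀ x, q x = m • qGen ℓ x := by
  obtain ⟨r, hr⟩ := QuotientAddGroup.mk_surjective (q 1)
  replace hr : (r : QZ) = q 1 := hr
  have h := hq.two_mul_zsmul_apply_one
  rw [← hr, QZ.zsmul_coe, QZ.coe_eq_zero_iff] at h
  obtain ⟨m, hm⟩ := h
  refine ⟨m, fun x => ?_⟩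
  obtain ⟨a, rfl⟩ := ZMod.intCast_surjective x
  rw [hq.apply_intCast, qGen_intCast hℓ, ← hr, QZ.zsmul_coe, QZ.zsmul_coe, hm]
  congr 1
  push_cast
  field_simp
  ring

theorem zsmul_qGen_eq_zero_iff {ℓ : ℕ} (hℓ : 1 ≤ ℓ) (m : ℤ) :
    (∀ x : ZMod (2 ^ ℓ), m • qGen ℓ x = 0) ↔ (2 : ℤ) ^ (ℓ + 1) ∣ m := by
  constructor
  · intro h
    have h₁ := h ((1 : ℤ) : ZMod (2 ^ ℓ))
    rw [qGen_intCast hℓ, QZ.zsmul_coe, QZ.coe_eq_zero_iff] at h₁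
    obtain ⟨n, hn⟩ := h₁
    refine ⟨n, ?_⟩
    have h₂ : (m : ℚ) = 2 ^ (ℓ + 1) * n := by
      rw [hn]
      push_cast
      field_simp
    exact_mod_cast h₂
  · rintro ⟨n, rfl⟩ x
    obtain ⟨a, rfl⟩ := ZMod.intCast_surjective x
    rw [qGen_intCast hℓ, QZ.zsmul_coe, QZ.coe_eq_zero_iff]
    refine ⟨n * a ^ 2, ?_⟩
    push_cast
    field_simp

theorem isQuadratic_zero {A : Type*} [AddCommGroup A] : IsQuadratic (fun _ : A => (0 : QZ)) := by
  simp [IsQuadratic, polar]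

theorem IsQuadratic.add {A : Type*} [AddCommGroup A] {q q' : A → QZ} (hq : IsQuadratic q)
    (hq' : IsQuadratic q') : IsQuadratic (fun x => q x + q' x) := by
  have hp (x y : A) : polar (fun x => q x + q' x) x y = polar q x y + polar q' x y := by
    simp only [polar]
    abel
  refine ⟨fun n x => ?_, fun x x' y => ?_, fun x y y' => ?_⟩
  · simp only [hq.1, hq'.1, smul_add]
  · rw [hp, hp, hp, hq.2.1, hq'.2.1, add_add_add_comm]
  · rw [hp, hp, hp, hq.2.2, hq'.2.2, add_add_add_comm]

theorem IsQuadratic.neg {A : Type*} [AddCommGroup A] {q : A → QZ} (hq : IsQuadratic q) :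
    IsQuadratic (fun x => -(q x)) := by
  have hp (x y : A) : polar (fun x => -(q x)) x y = -polar q x y := by
    simp only [polar]
    abel
  refine ⟨fun n x => ?_, fun x x' y => ?_, fun x y y' => ?_⟩
  · simp only [hq.1, smul_neg]
  · rw [hp, hp, hp, hq.2.1, neg_add]
  · rw [hp, hp, hp, hq.2.2, neg_add]

theorem quadratic_functions_on_cyclic_two_group (ℓ : ℕ) (hℓ : 1 ≤ ℓ) :
    -- the set of quadratic functions is an abelian group under pointwise addition
    IsQuadratic (fun _ : ZMod (2 ^ ℓ) => (0 : QZ)) ∧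
    (∀ q q' : ZMod (2 ^ ℓ) → QZ, IsQuadratic q → IsQuadratic q' →
      IsQuadratic (fun x => q x + q' x)) ∧
    (∀ q : ZMod (2 ^ ℓ) → QZ, IsQuadratic q → IsQuadratic (fun x => -(q x))) ∧
    -- q_ℓ is a quadratic function
    IsQuadratic (qGen ℓ) ∧
    -- every quadratic function is an integer multiple of q_ℓ
    (∀ q : ZMod (2 ^ ℓ) → QZ, IsQuadratic q →
      ∃ m : ℤ, ∀ x : ZMod (2 ^ ℓ), q x = m • qGen ℓ x) ∧
    -- the order of q_ℓ is exactly 2^(ℓ+1)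
    (∀ m : ℤ, (∀ x : ZMod (2 ^ ℓ), m • qGen ℓ x = 0) ↔ ((2 : ℤ) ^ (ℓ + 1)) ∣ m) := by
  exact ⟨isQuadratic_zero, fun _ _ hq hq' => hq.add hq', fun _ hq => hq.neg, isQuadratic_qGen hℓ,
    fun _ hq => hq.exists_eq_zsmul_qGen hℓ, zsmul_qGen_eq_zero_iff hℓ⟩
end

section
/- Let B and D be finite abelian groups and let q : B × D → ℚ/ℤ be a quadratic function on the direct sum B ⊕ D. Then there exists a function ς : (B × D) × (B × D) → ℚ/ℤ, additive in each variable, with q(v) = ς(v,v) for all v, if and only if both restrictions b ↦ q(b,0) and d ↦ q(0,d) are of this form, i.e. there exist biadditive forms ς_B on B and ς_D on D with q(b,0) = ς_B(b,b) and q(0,d) = ς_D(d,d) for all b ∈ B, d ∈ D. (This expresses the additivity of the functor J(B) = coker(Hom(B ⊗ B, ℚ/ℤ) → Q(B,ℚ/ℤ)).) -/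
theorem IsBiadditive.comp {A A' : Type*} [AddCommGroup A] [AddCommGroup A']
    {ς : A → A → QZ} (h : IsBiadditive ς) (f g : A' →+ A) :
    IsBiadditive fun x y => ς (f x) (g y) :=
  ⟨fun x x' y => by simp only [map_add, h.1], fun x y y' => by simp only [map_add, h.2]⟩

theorem IsBiadditive.add {A : Type*} [AddCommGroup A] {ς τ : A → A → QZ}
    (hς : IsBiadditive ς) (hτ : IsBiadditive τ) :
    IsBiadditive fun x y => ς x y + τ x y :=
  ⟨fun x x' y => by simp only [hς.1, hτ.1]; abel, fun x y y' => by simp only [hς.2, hτ.2]; abel⟩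

theorem IsQuadratic.isBiadditive_polar {A : Type*} [AddCommGroup A] {q : A → QZ}
    (hq : IsQuadratic q) : IsBiadditive (polar q) :=
  hq.2

theorem diagonal_on_direct_sum_iff_on_summands
    {B D : Type*} [AddCommGroup B] [AddCommGroup D] [Finite B] [Finite D]
    (q : B × D → QZ) (hq : IsQuadratic q) :
    (∃ ς : B × D → B × D → QZ, IsBiadditive ς ∧ ∀ v : B × D, q v = ς v v) ↔
    ((∃ ςB : B → B → QZ, IsBiadditive ςB ∧ ∀ b : B, q (b, 0) = ςB b b) ∧
     (∃ ςD : D → D → QZ, IsBiadditive ςD ∧ ∀ d : D, q (0, d) = ςD d d)) := by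
  constructor
  · rintro ⟨ς, hς, h⟩
    exact ⟨⟨_, hς.comp (.inl B D) (.inl B D), fun b => h (b, 0)⟩,
      ⟨_, hς.comp (.inr B D) (.inr B D), fun d => h (0, d)⟩⟩
  · rintro ⟨⟨ςB, hςB, hB⟩, ⟨ςD, hςD, hD⟩⟩
    -- The cross term is the polarisation of `q` between the two summands.
    refine ⟨_, ((hςB.comp (.fst B D) (.fst B D)).add (hςD.comp (.snd B D) (.snd B D))).add
      (hq.isBiadditive_polar.comp ((AddMonoidHom.inl B D).comp (.fst B D))
        ((AddMonoidHom.inr B D).comp (.snd B D))), ?_⟩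
    rintro ⟨b, d⟩
    simp [polar, ← hB, ← hD]
end

section
/- Let ℓ ≥ 1, let A = ℤ/2^(2ℓ)ℤ, and let q : A → ℚ/ℤ be a quadratic function such that q vanishes on the subgroup 2^ℓ·A = {2^ℓ • a | a ∈ A} (the unique subgroup of order 2^ℓ). Then the polarisation σ(x,y) = q(x+y) − q(x) − q(y) is degenerate: there exists x ∈ A with x ≠ 0 and σ(x,y) = 0 for all y ∈ A. (Consequently, the cyclic group ℤ/2^(2ℓ)ℤ is not realizable as a Lagrangian extension of ℤ/2^ℓℤ.) -/
/-- On multiples of a single element, the polarisation of a quadratic function is `2mn • q x`. -/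
theorem IsQuadratic.polar_zsmul_zsmul {A : Type*} [AddCommGroup A] {q : A → QZ}
    (hq : IsQuadratic q) (m n : ℤ) (x : A) :
    polar q (m • x) (n • x) = (2 * m * n) • q x := by
  rw [polar, ← add_smul, hq.1, hq.1, hq.1, ← sub_smul, ← sub_smul]
  congr 1
  ring

theorem no_lagrangian_in_big_cyclic (ℓ : ℕ) (hℓ : 1 ≤ ℓ)
    (q : ZMod (2 ^ (2 * ℓ)) → QZ) (hq : IsQuadratic q)
    (hvanish : ∀ a : ZMod (2 ^ (2 * ℓ)), q (2 ^ ℓ • a) = 0) :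
    ∃ x : ZMod (2 ^ (2 * ℓ)), x ≠ 0 ∧ ∀ y : ZMod (2 ^ (2 * ℓ)), polar q x y = 0 := by
  obtain ⟨k, hk⟩ : ∃ k, 2 * ℓ = k + 1 := ⟨2 * ℓ - 1, by omega⟩
  have hq1 : (2 ^ (2 * ℓ) : ℤ) • q 1 = 0 := by
    have h := hq.1 (2 ^ ℓ) 1
    rw [← pow_mul, mul_comm ℓ 2] at h
    rw [← h, ← hvanish 1]
    congr 1
    simp
  refine ⟨(2 ^ k : ℤ) • 1, fun h ↦ ?_, fun y ↦ ?_⟩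
  · have h' : ((2 ^ k : ℕ) : ZMod (2 ^ (2 * ℓ))) = 0 := by simpa using h
    rw [ZMod.natCast_eq_zero_iff, hk, Nat.pow_dvd_pow_iff_le_right (by norm_num)] at h'
    omega
  · obtain ⟨n, rfl⟩ := ZMod.intCast_surjective y
    rw [← zsmul_one n, hq.polar_zsmul_zsmul,
      show (2 * 2 ^ k * n : ℤ) = n * 2 ^ (2 * ℓ) by rw [hk]; ring, mul_smul, hq1, smul_zero]
end

section
/- Let ℓ ≥ 1 and let A = ℤ/2^(2ℓ−1)ℤ × ℤ/2ℤ. Define q : A → ℚ/ℤ by q(a,b) = (ā² / 2^(2ℓ)) − (b̄² / 4) mod ℤ, where ā ∈ {0,…,2^(2ℓ−1)−1} and b̄ ∈ {0,1} are canonical representatives. Then: (i) q is a quadratic function on A; (ii) q is non-degenerate; (iii) the cyclic subgroup L of A generated by the element (2^(ℓ−1), 1) is isotropic (q vanishes on L), has order 2^ℓ (hence L ≅ ℤ/2^ℓℤ), and is Lagrangian: L = L^⊥ = {x ∈ A | σ(x,y) = 0 for all y ∈ L}. -/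
theorem QZ.coe_eq_coe_iff (r s : ℚ) : (r : QZ) = (s : QZ) ↔ ∃ k : ℤ, r - s = k := by
  rw [← sub_eq_zero, ← AddCircle.coe_sub, AddCircle.coe_eq_zero_iff]
  simp [eq_comm]

/-- The function `(a, b) ↦ a² / (2N) - b² / 4` on `ℤ/N × ℤ/2`, computed on canonical
representatives. -/
def diagonalForm (N : ℕ) (p : ZMod N × ZMod 2) : QZ :=
  (((p.1.val ^ 2 : ℚ) / (2 * N) - (p.2.val ^ 2 : ℚ) / 4 : ℚ) : QZ)

theorem exists_val_intCast_sq_div (N : ℕ) [NeZero N] (hN : Even N) (a : ℤ) :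
    ∃ k : ℤ, (((a : ZMod N).val : ℚ) ^ 2) / (2 * N) - (a : ℚ) ^ 2 / (2 * N) = k := by
  obtain ⟨m, hm⟩ := hN
  have hval : (((a : ZMod N).val : ℤ)) = a - N * (a / N) := by
    rw [ZMod.val_intCast, Int.emod_def]
  have hval' : (((a : ZMod N).val : ℚ)) = a - N * ((a / N : ℤ) : ℚ) := by
    exact_mod_cast hval
  have hm' : (N : ℚ) = 2 * m := by rw [hm]; push_cast; ring
  have h0 : (m : ℚ) ≠ 0 := by
    intro h
    rw [h, mul_zero, Nat.cast_eq_zero] at hm'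
    exact NeZero.ne N hm'
  refine ⟨-(a * (a / N)) + m * (a / N) ^ 2, ?_⟩
  rw [hval']
  push_cast
  generalize (((a / N : ℤ)) : ℚ) = c
  rw [hm']
  field_simp
  ring

theorem diagonalForm_intCast (N : ℕ) [NeZero N] (hN : Even N) (a b : ℤ) :
    diagonalForm N ((a : ZMod N), (b : ZMod 2)) =
      (((a : ℚ) ^ 2 / (2 * N) - (b : ℚ) ^ 2 / 4 : ℚ) : QZ) := by
  obtain ⟨k, hk⟩ := exists_val_intCast_sq_div N hN a
  obtain ⟨l, hl⟩ := exists_val_intCast_sq_div 2 even_two b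
  refine (QZ.coe_eq_coe_iff _ _).2 ⟨k - l, ?_⟩
  push_cast at hl ⊢
  rw [← hk, ← hl]
  ring

theorem exists_intCast_pair (N : ℕ) (x : ZMod N × ZMod 2) :
    ∃ a b : ℤ, x = ((a : ZMod N), (b : ZMod 2)) := by
  obtain ⟨a, ha⟩ := ZMod.intCast_surjective x.1
  obtain ⟨b, hb⟩ := ZMod.intCast_surjective x.2
  exact ⟨a, b, by rw [ha, hb]⟩

theorem polar_diagonalForm_intCast (N : ℕ) [NeZero N] (hN : Even N) (a b c d : ℤ) :
    polar (diagonalForm N) ((a : ZMod N), (b : ZMod 2)) ((c : ZMod N), (d : ZMod 2)) =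
      (((a : ℚ) * c / N - (b : ℚ) * d / 2 : ℚ) : QZ) := by
  have hN0 : (N : ℚ) ≠ 0 := by exact_mod_cast NeZero.ne N
  rw [polar, Prod.mk_add_mk, ← Int.cast_add, ← Int.cast_add, diagonalForm_intCast N hN,
    diagonalForm_intCast N hN, diagonalForm_intCast N hN, ← AddCircle.coe_sub,
    ← AddCircle.coe_sub]
  congr 1
  push_cast
  field_simp
  ring

theorem polar_comm {A : Type*} [AddCommGroup A] (q : A → QZ) (x y : A) :
    polar q x y = polar q y x := by
  rw [polar, polar, add_comm x y, sub_right_comm]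

theorem isQuadratic_diagonalForm (N : ℕ) [NeZero N] (hN : Even N) :
    IsQuadratic (diagonalForm N) := by
  have hadd (x x' y : ZMod N × ZMod 2) : polar (diagonalForm N) (x + x') y =
      polar (diagonalForm N) x y + polar (diagonalForm N) x' y := by
    obtain ⟨a, b, rfl⟩ := exists_intCast_pair N x
    obtain ⟨a', b', rfl⟩ := exists_intCast_pair N x'
    obtain ⟨c, d, rfl⟩ := exists_intCast_pair N y
    rw [Prod.mk_add_mk, ← Int.cast_add, ← Int.cast_add, polar_diagonalForm_intCast N hN,
      polar_diagonalForm_intCast N hN, polar_diagonalForm_intCast N hN, ← AddCircle.coe_add]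
    congr 1
    push_cast
    ring
  refine ⟨fun n x => ?_, hadd, fun x y y' => ?_⟩
  · obtain ⟨a, b, rfl⟩ := exists_intCast_pair N x
    rw [Prod.smul_mk, zsmul_eq_mul, zsmul_eq_mul, ← Int.cast_mul, ← Int.cast_mul,
      diagonalForm_intCast N hN, diagonalForm_intCast N hN, ← AddCircle.coe_zsmul]
    congr 1
    rw [zsmul_eq_mul]
    push_cast
    ring
  · rw [polar_comm, hadd, polar_comm _ y, polar_comm _ y']

theorem eq_zero_of_polar_diagonalForm_eq_zero (N : ℕ) [NeZero N] (hN : Even N)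
    (x : ZMod N × ZMod 2) (hx : ∀ y, polar (diagonalForm N) x y = 0) : x = 0 := by
  have hN0 : (N : ℚ) ≠ 0 := by exact_mod_cast NeZero.ne N
  obtain ⟨a, b, rfl⟩ := exists_intCast_pair N x
  have h1 := hx (((1 : ℤ) : ZMod N), ((0 : ℤ) : ZMod 2))
  have h2 := hx (((0 : ℤ) : ZMod N), ((1 : ℤ) : ZMod 2))
  rw [polar_diagonalForm_intCast N hN, ← AddCircle.coe_zero, QZ.coe_eq_coe_iff] at h1 h2
  obtain ⟨k, hk⟩ := h1
  obtain ⟨l, hl⟩ := h2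
  refine Prod.ext ((ZMod.intCast_zmod_eq_zero_iff_dvd _ _).2 ⟨k, ?_⟩)
    ((ZMod.intCast_zmod_eq_zero_iff_dvd _ _).2 ⟨-l, ?_⟩)
  · push_cast at hk
    field_simp at hk
    have : (a : ℚ) = N * k := by linarith
    exact_mod_cast this
  · push_cast [mul_zero, zero_div] at hl
    have : (b : ℚ) = 2 * -l := by linarith
    exact_mod_cast this

theorem diagonalForm_zsmul_generator (n : ℕ) (k : ℤ) :
    diagonalForm (2 ^ (2 * n + 1)) (k • ((2 ^ n : ZMod (2 ^ (2 * n + 1))), (1 : ZMod 2))) = 0 := by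
  have hN : Even (2 ^ (2 * n + 1)) := even_two.pow_of_ne_zero (by omega)
  have hg : ((2 ^ n : ZMod (2 ^ (2 * n + 1))), (1 : ZMod 2)) =
      (((2 ^ n : ℤ) : ZMod (2 ^ (2 * n + 1))), ((1 : ℤ) : ZMod 2)) := by push_cast; rfl
  rw [(isQuadratic_diagonalForm _ hN).1, hg, diagonalForm_intCast _ hN]
  have hval : ((2 ^ n : ℤ) : ℚ) ^ 2 / (2 * (2 ^ (2 * n + 1) : ℕ)) - ((1 : ℤ) : ℚ) ^ 2 / 4 = 0 := by
    push_cast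
    have : (2 : ℚ) ^ (2 * n + 1) = 2 * (2 ^ n) ^ 2 := by ring
    rw [this]
    field_simp
    norm_num
  rw [hval, AddCircle.coe_zero, smul_zero]

theorem addOrderOf_generator (n : ℕ) :
    addOrderOf ((2 ^ n : ZMod (2 ^ (2 * n + 1))), (1 : ZMod 2)) = 2 ^ (n + 1) := by
  refine addOrderOf_eq_prime_pow (fun h => ?_) ?_
  · have h1 := congrArg Prod.fst h
    have h2 : ((2 ^ (2 * n) : ℕ) : ZMod (2 ^ (2 * n + 1))) = 0 := by
      refine Eq.trans ?_ h1
      rw [Prod.smul_fst, nsmul_eq_mul]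
      push_cast
      ring
    rw [ZMod.natCast_eq_zero_iff, Nat.pow_dvd_pow_iff_le_right (by norm_num)] at h2
    omega
  · have h2 : ((2 ^ (2 * n + 1) : ℕ) : ZMod (2 ^ (2 * n + 1))) = 0 := ZMod.natCast_self _
    have h3 : ((2 ^ (n + 1) : ℕ) : ZMod 2) = 0 := by
      rw [ZMod.natCast_eq_zero_iff]
      exact dvd_pow_self 2 (by omega)
    refine Prod.ext ?_ ?_
    · rw [Prod.smul_fst, nsmul_eq_mul, Prod.fst_zero, ← h2]
      push_cast
      ring
    · rw [Prod.smul_snd, nsmul_eq_mul, h3, zero_mul, Prod.snd_zero]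

theorem mem_zmultiples_generator_of_polar_eq_zero (n : ℕ)
    (x : ZMod (2 ^ (2 * n + 1)) × ZMod 2)
    (hx : polar (diagonalForm (2 ^ (2 * n + 1))) x
      ((2 ^ n : ZMod (2 ^ (2 * n + 1))), (1 : ZMod 2)) = 0) :
    x ∈ AddSubgroup.zmultiples ((2 ^ n : ZMod (2 ^ (2 * n + 1))), (1 : ZMod 2)) := by
  have hN : Even (2 ^ (2 * n + 1)) := even_two.pow_of_ne_zero (by omega)
  have hg : ((2 ^ n : ZMod (2 ^ (2 * n + 1))), (1 : ZMod 2)) =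
      (((2 ^ n : ℤ) : ZMod (2 ^ (2 * n + 1))), ((1 : ℤ) : ZMod 2)) := by push_cast; rfl
  obtain ⟨a, b, rfl⟩ := exists_intCast_pair _ x
  rw [hg, polar_diagonalForm_intCast _ hN, ← AddCircle.coe_zero, QZ.coe_eq_coe_iff] at hx
  obtain ⟨k, hk⟩ := hx
  have ha : a = (b + 2 * k) * 2 ^ n := by
    push_cast at hk
    have : (2 : ℚ) ^ (2 * n + 1) = 2 * (2 ^ n) ^ 2 := by ring
    rw [this] at hk
    field_simp at hk
    have : (a : ℚ) = (b + 2 * k) * 2 ^ n := by linarith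
    exact_mod_cast this
  refine ⟨b + 2 * k, ?_⟩
  have h2 : (2 : ZMod 2) = 0 := rfl
  refine Prod.ext ?_ ?_
  · simp [ha]
  · simp [h2]

theorem lagrangian_in_nonsplit_extension (ℓ : ℕ) (hℓ : 1 ≤ ℓ) :
    let A := ZMod (2 ^ (2 * ℓ - 1)) × ZMod 2
    let q : A → QZ := fun p =>
      (((p.1.val ^ 2 : ℚ) / 2 ^ (2 * ℓ) - (p.2.val ^ 2 : ℚ) / 4 : ℚ) : QZ)
    let g : A := ((2 ^ (ℓ - 1) : ZMod (2 ^ (2 * ℓ - 1))), (1 : ZMod 2))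
    let L := AddSubgroup.zmultiples g
    -- (i) q is a quadratic function
    IsQuadratic q ∧
    -- (ii) q is non-degenerate
    (∀ x : A, (∀ y : A, polar q x y = 0) → x = 0) ∧
    -- (iii) L is isotropic, of order 2^ℓ, and Lagrangian
    (∀ x ∈ L, q x = 0) ∧
    Nat.card L = 2 ^ ℓ ∧
    (L : Set A) = {x : A | ∀ y ∈ L, polar q x y = 0} := by
  obtain ⟨n, rfl⟩ : ∃ n, ℓ = n + 1 := ⟨ℓ - 1, by omega⟩
  intro A q g L
  have hN : Even (2 ^ (2 * n + 1)) := even_two.pow_of_ne_zero (by omega)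
  have hq : q = diagonalForm (2 ^ (2 * n + 1)) := by
    funext p
    have : (2 : ℚ) ^ (2 * (n + 1)) = 2 * ((2 ^ (2 * n + 1) : ℕ) : ℚ) := by push_cast; ring
    simp only [q, this]
    rfl
  have hiso : ∀ x ∈ L, q x = 0 := by
    rintro _ ⟨k, rfl⟩
    rw [hq]
    exact diagonalForm_zsmul_generator n k
  refine ⟨?_, ?_, hiso, ?_, ?_⟩
  · rw [hq]
    exact isQuadratic_diagonalForm _ hN
  · rw [hq]
    exact eq_zero_of_polar_diagonalForm_eq_zero _ hN
  · rw [Nat.card_zmultiples]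
    exact addOrderOf_generator n
  · refine Set.Subset.antisymm (fun x hx y hy => ?_) (fun x hx => ?_)
    · rw [polar, hiso _ (L.add_mem hx hy), hiso x hx, hiso y hy, sub_zero, sub_zero]
    · have := hx g (AddSubgroup.mem_zmultiples g)
      rw [hq] at this
      exact mem_zmultiples_generator_of_polar_eq_zero n x this
end

section
/- Let B, D, E be finite abelian groups and let 0 → B →ι E →π Hom(D,ℚ/ℤ) → 0 be a short exact sequence (ι injective, π surjective, ker π = im ι). On the group E × Hom(E,ℚ/ℤ) consider the standard quadratic function q_std(e,ε) := ε(e). Then: (i) q_std is a non-degenerate quadratic function on E × Hom(E,ℚ/ℤ); (ii) the subgroup S := {(ι(b), ε_d) | b ∈ B, d ∈ D}, where ε_d ∈ Hom(E,ℚ/ℤ) is defined by ε_d(x) := π(x)(d), is a Lagrangian subgroup: q_std vanishes on S and S = S^⊥ with respect to the polarisation of q_std. -/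
theorem QZ.exists_zsmul_eq_of_nsmul_eq_zero {n : ℕ} (hn : 0 < n) {u : QZ} (hu : n • u = 0) :
    ∃ m : ℤ, m • (((1 : ℚ) / n : ℚ) : QZ) = u := by
  obtain ⟨m, -, hm⟩ := (AddCircle.nsmul_eq_zero_iff (p := (1 : ℚ)) hn).mp hu
  refine ⟨m, ?_⟩
  rw [← hm, ← AddCircle.coe_zsmul]
  congr 1
  simp [div_eq_mul_inv]

instance QZ.hasEnoughRootsOfUnity (n : ℕ) [NeZero n] :
    HasEnoughRootsOfUnity (Multiplicative QZ) n := by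
  have hn : 0 < n := NeZero.pos n
  have hord : IsPrimitiveRoot (Multiplicative.ofAdd (((1 : ℚ) / n : ℚ) : QZ)) n := by
    rw [IsPrimitiveRoot.iff_orderOf, orderOf_ofAdd_eq_addOrderOf]
    exact AddCircle.addOrderOf_period_div hn
  refine ⟨⟨_, hord⟩, ⟨hord.toRootsOfUnity, fun x => ?_⟩⟩
  have hx : n • (Multiplicative.toAdd (x : (Multiplicative QZ)ˣ).val) = 0 := by
    have h := (mem_rootsOfUnity' n _).mp x.2
    simpa using congrArg Multiplicative.toAdd h
  obtain ⟨m, hm⟩ := QZ.exists_zsmul_eq_of_nsmul_eq_zero hn hx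
  refine ⟨m, Subtype.ext ?_⟩
  apply (toUnits (G := Multiplicative QZ)).symm.injective
  have : (toUnits (G := Multiplicative QZ)).symm
      ((hord.toRootsOfUnity ^ m : rootsOfUnity n (Multiplicative QZ)) : (Multiplicative QZ)ˣ) =
      Multiplicative.ofAdd (((1 : ℚ) / n : ℚ) : QZ) ^ m := by
    rw [Subgroup.coe_zpow, map_zpow]
    rfl
  rw [this, ← ofAdd_zsmul, hm]
  rfl

theorem QZ.natCard_addMonoidHom (A : Type*) [AddCommGroup A] [Finite A] :
    Nat.card (A →+ QZ) = Nat.card A := by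
  have h := CommGroup.card_monoidHom_of_hasEnoughRootsOfUnity
    (Multiplicative A) (Multiplicative QZ)
  rw [Nat.card_congr (Multiplicative.toAdd (α := A))] at h
  rw [← h]
  exact Nat.card_congr (AddMonoidHom.toMultiplicative.trans
    (MulEquiv.monoidHomCongrRight (toUnits (G := Multiplicative QZ))).toEquiv)

/-- Evaluation `A → Hom(Hom(A, ℚ/ℤ), ℚ/ℤ)` is surjective for `A` finite. -/
theorem QZ.eval_surjective (A : Type*) [AddCommGroup A] [Finite A] :
    Function.Surjective (AddMonoidHom.eval : A →+ (A →+ QZ) →+ QZ) := by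
  have := Nat.finite_of_card_ne_zero (α := A →+ QZ)
    (by rw [QZ.natCard_addMonoidHom]; exact Nat.card_pos.ne')
  have := Nat.finite_of_card_ne_zero (α := (A →+ QZ) →+ QZ)
    (by rw [QZ.natCard_addMonoidHom]; exact Nat.card_pos.ne')
  refine ((Nat.bijective_iff_injective_and_card _).mpr ⟨?_, ?_⟩).2
  · rw [injective_iff_map_eq_zero]
    exact fun a ha => CharacterModule.eq_zero_of_character_apply fun c => DFunLike.congr_fun ha c
  · rw [QZ.natCard_addMonoidHom, QZ.natCard_addMonoidHom]

theorem polar_hyperbolic {E : Type*} [AddCommGroup E] (x y : E × (E →+ QZ)) :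
    polar (fun p : E × (E →+ QZ) => p.2 p.1) x y = x.2 y.1 + y.2 x.1 := by
  simp only [polar, Prod.fst_add, Prod.snd_add, AddMonoidHom.add_apply, map_add]
  abel

theorem isQuadratic_hyperbolic (E : Type*) [AddCommGroup E] :
    IsQuadratic (fun p : E × (E →+ QZ) => p.2 p.1) := by
  refine ⟨fun n x => ?_, fun x x' y => ?_, fun x y y' => ?_⟩
  · change (n • x.2) (n • x.1) = _
    rw [AddMonoidHom.zsmul_apply, map_zsmul, smul_smul, sq]
  all_goals
    simp only [polar_hyperbolic, Prod.fst_add, Prod.snd_add, AddMonoidHom.add_apply, map_add]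
    abel

theorem exists_forall_eq_apply_of_exact {B D E : Type*} [AddCommGroup B] [AddCommGroup D]
    [AddCommGroup E] [Finite D] (ι : B →+ E) (π : E →+ (D →+ QZ))
    (hπ : Function.Surjective π) (hexact : ∀ e : E, π e = 0 ↔ ∃ b : B, ι b = e)
    (ε : E →+ QZ) (hε : ∀ b, ε (ι b) = 0) : ∃ d : D, ∀ x, ε x = π x d := by
  have hker : π.ker ≤ ε.ker := fun e he => by
    obtain ⟨b, rfl⟩ := (hexact e).mp he
    exact hε b
  obtain ⟨d, hd⟩ := QZ.eval_surjective D (π.liftOfSurjective hπ ⟨ε, hker⟩)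
  refine ⟨d, fun x => ?_⟩
  have h := DFunLike.congr_fun hd (π x)
  rw [AddMonoidHom.liftOfRightInverse_comp_apply] at h
  exact h.symm

theorem standard_hyperbolic_lagrangian
    {B D E : Type*} [AddCommGroup B] [AddCommGroup D] [AddCommGroup E]
    [Finite B] [Finite D] [Finite E]
    (ι : B →+ E) (π : E →+ (D →+ QZ))
    (hι : Function.Injective ι) (hπ : Function.Surjective π)
    (hexact : ∀ e : E, π e = 0 ↔ ∃ b : B, ι b = e) :
    let qstd : E × (E →+ QZ) → QZ := fun p => p.2 p.1
    let S : Set (E × (E →+ QZ)) :=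
      {p | ∃ (b : B) (d : D), p.1 = ι b ∧ ∀ x : E, p.2 x = π x d}
    -- (i) q_std is a non-degenerate quadratic function on E × Hom(E, ℚ/ℤ)
    IsQuadratic qstd ∧
    (∀ x : E × (E →+ QZ), (∀ y : E × (E →+ QZ), polar qstd x y = 0) → x = 0) ∧
    -- (ii) S = {(ι b, π(·)(d))} is a Lagrangian subgroup
    (∀ p ∈ S, qstd p = 0) ∧
    S = {x : E × (E →+ QZ) | ∀ y ∈ S, polar qstd x y = 0} := by
  intro qstd S
  refine ⟨isQuadratic_hyperbolic E, fun x hx => ?_, ?_, Set.ext fun x => ⟨?_, fun hx => ?_⟩⟩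
  · simp only [qstd, polar_hyperbolic] at hx
    refine Prod.ext (CharacterModule.eq_zero_of_character_apply fun c => ?_)
      (AddMonoidHom.ext fun f => ?_)
    · have h := hx (0, c)
      rw [map_zero, zero_add] at h
      exact h
    · simpa using hx (f, 0)
  · rintro p ⟨b, d, h1, h2⟩
    change p.2 p.1 = 0
    rw [h2, h1, (hexact _).mpr ⟨b, rfl⟩, AddMonoidHom.zero_apply]
  · rintro ⟨b, d, h1, h2⟩ y ⟨b', d', h1', h2'⟩
    rw [polar_hyperbolic, h2, h2', h1, h1', (hexact _).mpr ⟨b, rfl⟩, (hexact _).mpr ⟨b', rfl⟩]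
    simp
  · simp only [qstd, Set.mem_ofPred_eq, polar_hyperbolic] at hx
    have hfst : π x.1 = 0 := AddMonoidHom.ext fun d => by
      simpa using hx (0, π.flip d) ⟨0, d, (map_zero ι).symm, fun _ => rfl⟩
    have hsnd : ∀ b, x.2 (ι b) = 0 := fun b => by
      simpa using hx (ι b, 0) ⟨b, 0, rfl, fun _ => by simp⟩
    obtain ⟨b, hb⟩ := (hexact _).mp hfst
    obtain ⟨d, hd⟩ := exists_forall_eq_apply_of_exact ι π hπ hexact x.2 hsnd
    exact ⟨b, d, hb.symm, hd⟩
end
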